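/- arXiv:1409.0464 — 4 statements merged into one kernel-verified Lean document; each statement's English description precedes it below -/
import Mathlib

section
/- Let r ≥ 2, μ ∈ ℤ^r with all μ_i ≥ 1, μ' = υ(μ) = (2μ₁,…,2μ_{r−1},μ_r), and let q be an indeterminate. Let k ≥ 0 and s = (b₁,…,b_r) ∈ ℤ^r_{≥0} with b_i ≤ μ'_i for 1 ≤ i ≤ r−1, b₁ + ⋯ + b_r = k, and b_r < μ_r. If G_{Δ_C}(s) ≠ 0, then b_i is even for all 1 ≤ i ≤ r−1. -/
open Finset
open scoped Classical

noncomputable section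

namespace Stmt7

/-- `x = q^{1/2}`: the indeterminate of the field `ℚ(q^{1/2})`, so that `q = x²`. -/
def x : RatFunc ℚ := RatFunc.X

/-- `q = x²`. -/
def q : RatFunc ℚ := x ^ 2

/-- `υ(μ) = (2μ₁,…,2μ_{r−1},μ_r)` (1-based). -/
def ups (r : ℕ) (μ : ℕ → ℕ) : ℕ → ℕ := fun j => if j ≤ r - 1 then 2 * μ j else μ j

/-- The `j`-th entry (1-based) of the decorated array
`Δ_C(s) = (𝔟₁,…,𝔟_{2r−1})`: `𝔟₁ = 2k`, `𝔟_{i+1} = 2k − (b₁+⋯+bᵢ)` and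
`𝔟_{2r−i} = b₁+⋯+bᵢ` for `1 ≤ i ≤ r−1`, where `k = b₁+⋯+b_r`. -/
def bArr (r : ℕ) (b : ℕ → ℕ) (j : ℕ) : ℕ :=
  if j ≤ r then 2 * (∑ i ∈ Finset.Icc 1 r, b i) - ∑ i ∈ Finset.Icc 1 (j - 1), b i
  else ∑ i ∈ Finset.Icc 1 (2 * r - j), b i

/-- `𝔟ᵢ` (1 ≤ i ≤ r) and `𝔟_{2r−i}` (1 ≤ i ≤ r−1) are circled iff `bᵢ = 0`. -/
def CircledC (r : ℕ) (b : ℕ → ℕ) (j : ℕ) : Prop :=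
  if j ≤ r then b j = 0 else b (2 * r - j) = 0

/-- `𝔟ᵢ` (1 ≤ i ≤ r) is boxed iff `bᵢ = μ'ᵢ`; `𝔟_{2r−i}` (1 ≤ i ≤ r−1) is boxed iff
`b_{i+1} = μ'_{i+1}`. -/
def BoxedC (r : ℕ) (μ' b : ℕ → ℕ) (j : ℕ) : Prop :=
  if j ≤ r then b j = μ' j else b (2 * r - j + 1) = μ' (2 * r - j + 1)

/-- `γ̃(𝔟ⱼ)`. -/
def gamT (r : ℕ) (μ' b : ℕ → ℕ) (j : ℕ) : RatFunc ℚ :=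
  if BoxedC r μ' b j then
    (if CircledC r b j then 0 else if Even (bArr r b j) then -q⁻¹ else x⁻¹)
  else
    (if CircledC r b j then 1 else if Even (bArr r b j) then 1 - q⁻¹ else 0)

/-- `G_{Δ_C}(s) = ∏_{j=1}^{2r−1} γ̃(𝔟ⱼ)`. -/
def GDeltaC (r : ℕ) (μ' b : ℕ → ℕ) : RatFunc ℚ :=
  ∏ j ∈ Finset.Icc 1 (2 * r - 1), gamT r μ' b j

/-- In a nonvanishing product, an uncircled entry that is not boxed is even. -/
theorem even_bArr_of_GDeltaC_ne_zero {r : ℕ} {μ' b : ℕ → ℕ} (hG : GDeltaC r μ' b ≠ 0) {j : ℕ}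
    (hj : 1 ≤ j) (hjr : j ≤ 2 * r - 1) (hbox : ¬ BoxedC r μ' b j) (hcirc : ¬ CircledC r b j) :
    Even (bArr r b j) := by
  by_contra hodd
  refine Finset.prod_ne_zero_iff.mp hG j (Finset.mem_Icc.mpr ⟨hj, hjr⟩) ?_
  simp [gamT, hbox, hcirc, hodd]

/-- If the product does not vanish, then `b₁ + ⋯ + bᵢ` is even whenever `bᵢ ≠ 0`, `i ≤ r − 1`. -/
theorem even_partialSum_of_ne_zero {r : ℕ} {μ b : ℕ → ℕ}
    (hμ : ∀ i, 1 ≤ i → i ≤ r → 1 ≤ μ i) (hbr : b r < μ r) (hG : GDeltaC r (ups r μ) b ≠ 0)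
    {i : ℕ} (hi : 1 ≤ i) (hir : i < r) (hb : b i ≠ 0) :
    Even (∑ l ∈ Finset.Icc 1 i, b l) := by
  induction hd : r - i generalizing i with
  | zero => omega
  | succ d ih =>
    have hgt : ¬ 2 * r - i ≤ r := by omega
    have hsub : 2 * r - (2 * r - i) = i := by omega
    by_cases hbox : b (i + 1) = ups r μ (i + 1)
    · rcases (show i + 1 ≤ r from hir).eq_or_lt with hlast | hlt
      · have hups : ups r μ r = μ r := by
          simp only [ups]
          rw [if_neg (by omega)]
        rw [hlast, hups] at hbox
        omega
      · have hups : ups r μ (i + 1) = 2 * μ (i + 1) := by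
          simp only [ups]
          rw [if_pos (by omega)]
        have hpos := hμ (i + 1) (by omega) hir
        have hnext := ih (i := i + 1) (by omega) hlt (by omega) (by omega)
        rw [Finset.sum_Icc_succ_top (by omega), hbox, hups] at hnext
        exact (Nat.even_add.mp hnext).mpr (even_two_mul _)
    · have heven := even_bArr_of_GDeltaC_ne_zero hG (j := 2 * r - i) (by omega) (by omega)
        (by simpa [BoxedC, hgt, hsub] using hbox) (by simpa [CircledC, hgt, hsub] using hb)
      simpa [bArr, hgt, hsub] using heven

/-- If `s = (b₁,…,b_r)` satisfies `bᵢ ≤ μ'ᵢ` for `i ≤ r−1`, `Σbᵢ = k` and `b_r < μ_r`,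
and `G_{Δ_C}(s) ≠ 0`, then `bᵢ` is even for all `1 ≤ i ≤ r−1`. -/
theorem stmt7 (r : ℕ) (hr : 2 ≤ r) (μ : ℕ → ℕ)
    (hμ : ∀ i, 1 ≤ i → i ≤ r → 1 ≤ μ i) (k : ℕ) (b : ℕ → ℕ)
    (hble : ∀ i, 1 ≤ i → i ≤ r - 1 → b i ≤ ups r μ i)
    (hsum : ∑ i ∈ Finset.Icc 1 r, b i = k)
    (hbr : b r < μ r)
    (hG : GDeltaC r (ups r μ) b ≠ 0) :
    ∀ i, 1 ≤ i → i ≤ r - 1 → Even (b i) := by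
  intro i hi hir
  by_contra hodd
  have hb : b i ≠ 0 := by
    intro h
    simp [h] at hodd
  have hle : i ≤ r := by omega
  have hbox : ¬ b i = ups r μ i := by
    intro h
    apply hodd
    simp [h, ups, hir]
  have hentry := even_bArr_of_GDeltaC_ne_zero hG hi (by omega)
    (by simpa [BoxedC, hle] using hbox) (by simpa [CircledC, hle] using hb)
  have hpartial := even_partialSum_of_ne_zero hμ hbr hG hi (by omega) hb
  have hmono : ∑ l ∈ Finset.Icc 1 (i - 1), b l ≤ ∑ l ∈ Finset.Icc 1 r, b l :=
    Finset.sum_le_sum_of_subset (Finset.Icc_subset_Icc_right (by omega))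
  obtain ⟨m, rfl⟩ : ∃ m, i = m + 1 := ⟨i - 1, by omega⟩
  rw [Finset.sum_Icc_succ_top (by omega)] at hpartial
  simp only [bArr, if_pos hle, Nat.add_sub_cancel] at hentry hmono
  rw [Nat.even_iff] at *
  omega

end Stmt7
end
end

section
/- Let r ≥ 2, μ ∈ ℤ^r with all μ_i ≥ 1, μ' = υ(μ) = (2μ₁,…,2μ_{r−1},μ_r), and let q be an indeterminate. Let k ≥ 0 and s = (b₁,…,b_r) ∈ ℤ^r_{≥0} with b_i ≤ μ'_i for 1 ≤ i ≤ r, b₁ + ⋯ + b_r = k, b_r = μ_r, and s ≠ μ'; set i_□ = i_□(s) = max{i : b_i < μ'_i}. If G_{Δ_C}(s) ≠ 0, then b_{i_□} ≡ k − μ_r (mod 2) and b_i is even for every 1 ≤ i ≤ r−1 with i ≠ i_□. -/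
open Finset
open scoped Classical

noncomputable section

namespace Stmt8

/-- `x = q^{1/2}`: the indeterminate of the field `ℚ(q^{1/2})`, so that `q = x²`. -/
def x : RatFunc ℚ := RatFunc.X

/-- `q = x²`. -/
def q : RatFunc ℚ := x ^ 2

/-- `υ(μ) = (2μ₁,…,2μ_{r−1},μ_r)` (1-based). -/
def ups (r : ℕ) (μ : ℕ → ℕ) : ℕ → ℕ := fun j => if j ≤ r - 1 then 2 * μ j else μ j

/-- The `j`-th entry (1-based) of the decorated array
`Δ_C(s) = (𝔟₁,…,𝔟_{2r−1})`: `𝔟₁ = 2k`, `𝔟_{i+1} = 2k − (b₁+⋯+bᵢ)` and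
`𝔟_{2r−i} = b₁+⋯+bᵢ` for `1 ≤ i ≤ r−1`, where `k = b₁+⋯+b_r`. -/
def bArr (r : ℕ) (b : ℕ → ℕ) (j : ℕ) : ℕ :=
  if j ≤ r then 2 * (∑ i ∈ Finset.Icc 1 r, b i) - ∑ i ∈ Finset.Icc 1 (j - 1), b i
  else ∑ i ∈ Finset.Icc 1 (2 * r - j), b i

/-- `𝔟ᵢ` (1 ≤ i ≤ r) and `𝔟_{2r−i}` (1 ≤ i ≤ r−1) are circled iff `bᵢ = 0`. -/
def CircledC (r : ℕ) (b : ℕ → ℕ) (j : ℕ) : Prop :=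
  if j ≤ r then b j = 0 else b (2 * r - j) = 0

/-- `𝔟ᵢ` (1 ≤ i ≤ r) is boxed iff `bᵢ = μ'ᵢ`; `𝔟_{2r−i}` (1 ≤ i ≤ r−1) is boxed iff
`b_{i+1} = μ'_{i+1}`. -/
def BoxedC (r : ℕ) (μ' b : ℕ → ℕ) (j : ℕ) : Prop :=
  if j ≤ r then b j = μ' j else b (2 * r - j + 1) = μ' (2 * r - j + 1)

/-- `γ̃(𝔟ⱼ)`. -/
def gamT (r : ℕ) (μ' b : ℕ → ℕ) (j : ℕ) : RatFunc ℚ :=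
  if BoxedC r μ' b j then
    (if CircledC r b j then 0 else if Even (bArr r b j) then -q⁻¹ else x⁻¹)
  else
    (if CircledC r b j then 1 else if Even (bArr r b j) then 1 - q⁻¹ else 0)

/-- `G_{Δ_C}(s) = ∏_{j=1}^{2r−1} γ̃(𝔟ⱼ)`. -/
def GDeltaC (r : ℕ) (μ' b : ℕ → ℕ) : RatFunc ℚ :=
  ∏ j ∈ Finset.Icc 1 (2 * r - 1), gamT r μ' b j


/-- An entry with nonvanishing weight that is neither boxed nor circled is even. -/
theorem even_bArr_of_gamT_ne_zero {r : ℕ} {μ' b : ℕ → ℕ} {j : ℕ} (h : gamT r μ' b j ≠ 0)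
    (hbox : ¬ BoxedC r μ' b j) (hcirc : ¬ CircledC r b j) : Even (bArr r b j) := by
  by_contra hodd
  exact h (by simp [gamT, hbox, hcirc, hodd])

/-- An entry with nonvanishing weight is not both boxed and circled. -/
theorem not_circledC_of_gamT_ne_zero {r : ℕ} {μ' b : ℕ → ℕ} {j : ℕ} (h : gamT r μ' b j ≠ 0)
    (hbox : BoxedC r μ' b j) : ¬ CircledC r b j := by
  intro hcirc
  exact h (by simp [gamT, hbox, hcirc])

/-- In the left half of the array, parity of an entry is parity of the preceding partial sum. -/
theorem even_bArr_iff {r : ℕ} (b : ℕ → ℕ) {j : ℕ} (hj : j ≤ r) :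
    Even (bArr r b j) ↔ Even (∑ i ∈ Finset.Icc 1 (j - 1), b i) := by
  have hle : ∑ i ∈ Finset.Icc 1 (j - 1), b i ≤ ∑ i ∈ Finset.Icc 1 r, b i :=
    Finset.sum_le_sum_of_subset (Finset.Icc_subset_Icc_right (by omega))
  rw [bArr, if_pos hj, Nat.even_sub (by omega)]
  simp

/-- If `s = (b₁,…,b_r)` satisfies `bᵢ ≤ μ'ᵢ` for all `i`, `Σbᵢ = k`, `b_r = μ_r`, and
`s ≠ μ'`, with `i_□ = max{i : bᵢ < μ'ᵢ}`, then `G_{Δ_C}(s) ≠ 0` implies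
`b_{i_□} ≡ k − μ_r (mod 2)` and `bᵢ` even for every `1 ≤ i ≤ r−1` with `i ≠ i_□`. -/
theorem stmt8 (r : ℕ) (hr : 2 ≤ r) (μ : ℕ → ℕ)
    (hμ : ∀ i, 1 ≤ i → i ≤ r → 1 ≤ μ i) (k : ℕ) (b : ℕ → ℕ)
    (hble : ∀ i, 1 ≤ i → i ≤ r → b i ≤ ups r μ i)
    (hsum : ∑ i ∈ Finset.Icc 1 r, b i = k)
    (hbr : b r = μ r)
    (hne : ∃ i, 1 ≤ i ∧ i ≤ r ∧ b i ≠ ups r μ i)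
    (iB : ℕ) (hiB1 : 1 ≤ iB) (hiB2 : iB ≤ r) (hiB3 : b iB < ups r μ iB)
    (hiBmax : ∀ i, 1 ≤ i → i ≤ r → b i < ups r μ i → i ≤ iB)
    (hG : GDeltaC r (ups r μ) b ≠ 0) :
    Int.ModEq 2 (b iB) ((k : ℤ) - (μ r : ℤ)) ∧
      ∀ i, 1 ≤ i → i ≤ r - 1 → i ≠ iB → Even (b i) := by
  have hw : ∀ j, 1 ≤ j → j ≤ 2 * r - 1 → gamT r (ups r μ) b j ≠ 0 := fun j h₁ h₂ =>
    Finset.prod_ne_zero_iff.mp hG j (Finset.mem_Icc.mpr ⟨h₁, h₂⟩)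
  have hups_r : ups r μ r = μ r := if_neg (by omega)
  have hups : ∀ i, i ≤ r - 1 → ups r μ i = 2 * μ i := fun i hi => if_pos hi
  have hiB_lt : iB < r := by
    rcases hiB2.lt_or_eq with h | rfl
    · exact h
    · omega
  have hfull : ∀ i, iB < i → i ≤ r → b i = ups r μ i := by
    intro i h₁ h₂
    by_contra hlt
    have := hiBmax i (by omega) h₂ (lt_of_le_of_ne (hble i (by omega) h₂) hlt)
    omega
  have hsucc : ∀ n, ∑ i ∈ Finset.Icc 1 (n + 1), b i = ∑ i ∈ Finset.Icc 1 n, b i + b (n + 1) :=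
    fun n => Finset.sum_Icc_succ_top (by omega) b
  have hleft : ∀ j, 1 ≤ j → j ≤ r → b j ≠ ups r μ j → b j ≠ 0 →
      Even (∑ i ∈ Finset.Icc 1 (j - 1), b i) := fun j h₁ h₂ h₃ h₄ =>
    (even_bArr_iff b h₂).mp (even_bArr_of_gamT_ne_zero (hw j h₁ (by omega))
      (by simpa [BoxedC, h₂] using h₃) (by simpa [CircledC, h₂] using h₄))
  have hiB_ne : b iB ≠ 0 := by
    have hj : ¬ 2 * r - iB ≤ r := by omega
    have hsub : 2 * r - (2 * r - iB) = iB := by omega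
    have := not_circledC_of_gamT_ne_zero (hw (2 * r - iB) (by omega) (by omega))
      (by simpa [BoxedC, hj, hsub] using hfull (iB + 1) (by omega) (by omega))
    simpa [CircledC, hj, hsub] using this
  have hstep : ∀ n, n + 1 < iB → Even (∑ i ∈ Finset.Icc 1 (n + 1), b i) →
      Even (∑ i ∈ Finset.Icc 1 n, b i) := by
    intro n hn he
    by_cases hb : Even (b (n + 1))
    · rw [hsucc, Nat.even_add] at he
      exact he.mpr hb
    · refine hleft (n + 1) (by omega) (by omega) (fun h => hb ?_) (fun h => hb (by simp [h]))
      rw [h, hups _ (by omega)]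
      exact even_two_mul _
  have hlow : ∀ d, d < iB → Even (∑ i ∈ Finset.Icc 1 (iB - 1 - d), b i) := by
    intro d
    induction d with
    | zero => exact fun _ => hleft iB hiB1 hiB2 hiB3.ne hiB_ne
    | succ d ih =>
      intro hd
      refine hstep _ (by omega) ?_
      rw [show iB - 1 - (d + 1) + 1 = iB - 1 - d by omega]
      exact ih (by omega)
  have hprefix : ∀ n, n < iB → Even (∑ i ∈ Finset.Icc 1 n, b i) := by
    intro n hn
    have := hlow (iB - 1 - n) (by omega)
    rwa [show iB - 1 - (iB - 1 - n) = n by omega] at this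
  have hhigh : ∀ i, iB < i → i ≤ r - 1 → Even (b i) := by
    intro i h₁ h₂
    rw [hfull i h₁ (by omega), hups i h₂]
    exact even_two_mul _
  have htail : ∀ n, iB ≤ n → n ≤ r - 1 →
      (Even (∑ i ∈ Finset.Icc 1 n, b i) ↔ Even (b iB)) := by
    intro n hn
    induction n, hn using Nat.le_induction with
    | base =>
      intro _
      have h := hsucc (iB - 1)
      rw [Nat.sub_add_cancel hiB1] at h
      simp [h, Nat.even_add, hprefix (iB - 1) (by omega)]
    | succ n hn ih =>
      intro h
      rw [hsucc, Nat.even_add, ih (by omega)]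
      simp [hhigh (n + 1) (by omega) h]
  constructor
  · have h := hsucc (r - 1)
    rw [Nat.sub_add_cancel (by omega), hsum, hbr] at h
    have hpar := htail (r - 1) (by omega) le_rfl
    rw [Nat.even_iff, Nat.even_iff] at hpar
    unfold Int.ModEq
    omega
  · intro i h₁ h₂ h₃
    rcases Nat.lt_or_gt_of_ne h₃ with h | h
    · have hs := hsucc (i - 1)
      rw [Nat.sub_add_cancel h₁] at hs
      have he := hprefix i h
      rw [hs, Nat.even_add] at he
      exact he.mp (hprefix (i - 1) (by omega))
    · exact hhigh i h h₂

end Stmt8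
end
end

section
/- Let r ≥ 2, μ ∈ ℤ^r with all μ_i ≥ 1, μ' = υ(μ) = (2μ₁,…,2μ_{r−1},μ_r), and let q be an indeterminate. Then for every integer k ≥ 0: Σ_{t ∈ Ω_B(μ,k)} G(t) = Σ_{s ∈ Ω^≤_A(μ',k)} G_{Δ_C}(s), as an identity in ℚ(q^{1/2}). -/
open Finset
open scoped Classical

noncomputable section

namespace Stmt13

/-- `x = q^{1/2}`: the generator of the field `ℚ(q^{1/2})`, so `q = x²`. -/
def x : RatFunc ℚ := RatFunc.X

/-- `q = x²`. -/
def q : RatFunc ℚ := x ^ 2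

/-- `υ(μ) = (2μ₁,…,2μ_{r−1},μ_r)` (1-based). -/
def ups (r : ℕ) (μ : ℕ → ℕ) : ℕ → ℕ := fun j => if j ≤ r - 1 then 2 * μ j else μ j

def Supported (r : ℕ) (d : ℕ → ℕ) : Prop := ∀ j, (j = 0 ∨ r < j) → d j = 0

/- ### Type B totally resonant machinery -/

/-- Entry `j` of the identified `(2r−1)`-tuple `(d₁,…,d_{r−1},d_r,d_{r−1},…,d₁)`. -/
def Dd (r : ℕ) (d : ℕ → ℕ) (j : ℕ) : ℕ := if j ≤ r then d j else d (2 * r - j)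

def Circled (r : ℕ) (d : ℕ → ℕ) (i : ℕ) : Prop := Dd r d i = 0

def Boxed (r : ℕ) (μ d : ℕ → ℕ) (i : ℕ) : Prop :=
  if i ≤ r then d i = μ i
  else if i = r + 1 then d r = μ r
  else d (2 * r - i + 1) = μ (2 * r - i + 1)

/-- `γ(𝔠ᵢ)`. -/
def gam (r : ℕ) (μ d : ℕ → ℕ) (i : ℕ) : RatFunc ℚ :=
  if Boxed r μ d i then (if Circled r d i then 0 else -q⁻¹)
  else (if Circled r d i then 1 else 1 - q⁻¹)

def GDelta (r : ℕ) (μ d : ℕ → ℕ) : RatFunc ℚ :=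
  ∏ i ∈ Finset.Icc 1 (2 * r - 1), gam r μ d i

/-- `G(t)`: equal to `G_Δ(t)` if `d_r ≤ μ_r`; to
`(1−q⁻¹) q^{−(d_r−μ_r+1)/2} ∏_{i≠r,r+1} γ(𝔠ᵢ)` if `d_r > μ_r` with `d_r − μ_r` odd;
and to `0` if `d_r > μ_r` with `d_r − μ_r` even. -/
def Gres (r : ℕ) (μ d : ℕ → ℕ) : RatFunc ℚ :=
  if d r ≤ μ r then GDelta r μ d
  else if Odd (d r - μ r) then
    (1 - q⁻¹) * (q ^ ((d r - μ r + 1) / 2))⁻¹ *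
      ∏ i ∈ ((Finset.Icc 1 (2 * r - 1)).erase r).erase (r + 1), gam r μ d i
  else 0

/- ### Type C machinery -/

/-- Entry `𝔟ⱼ` of the decorated array `Δ_C(u)`. -/
def bArr (r : ℕ) (b : ℕ → ℕ) (j : ℕ) : ℕ :=
  if j ≤ r then 2 * (∑ i ∈ Finset.Icc 1 r, b i) - ∑ i ∈ Finset.Icc 1 (j - 1), b i
  else ∑ i ∈ Finset.Icc 1 (2 * r - j), b i

def CircledC (r : ℕ) (b : ℕ → ℕ) (j : ℕ) : Prop :=
  if j ≤ r then b j = 0 else b (2 * r - j) = 0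

def BoxedC (r : ℕ) (μ' b : ℕ → ℕ) (j : ℕ) : Prop :=
  if j ≤ r then b j = μ' j else b (2 * r - j + 1) = μ' (2 * r - j + 1)

/-- `γ̃(𝔟ⱼ)`. -/
def gamT (r : ℕ) (μ' b : ℕ → ℕ) (j : ℕ) : RatFunc ℚ :=
  if BoxedC r μ' b j then
    (if CircledC r b j then 0 else if Even (bArr r b j) then -q⁻¹ else x⁻¹)
  else
    (if CircledC r b j then 1 else if Even (bArr r b j) then 1 - q⁻¹ else 0)

def GDeltaC (r : ℕ) (μ' b : ℕ → ℕ) : RatFunc ℚ :=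
  ∏ j ∈ Finset.Icc 1 (2 * r - 1), gamT r μ' b j

/- ### Combinatorial sets -/

/-- `Ω_B(μ,k) = {t ∈ ℤ^r_{≥0} : dᵢ ≤ μᵢ for i < r, k_B(t) = k}` where
`k_B(t) = d_r + 2(d₁+⋯+d_{r−1})`. -/
def OmegaB (r : ℕ) (μ : ℕ → ℕ) (k : ℕ) : Set (ℕ → ℕ) :=
  {t | Supported r t ∧ (∀ i, 1 ≤ i → i ≤ r - 1 → t i ≤ μ i) ∧
    t r + 2 * ∑ i ∈ Finset.Icc 1 (r - 1), t i = k}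

/-- `Ω^≤_A(μ',k) = {s ∈ ℤ^r_{≥0} : sᵢ ≤ μ'ᵢ for all i, Σsᵢ = k}`. -/
def OmegaLeA (r : ℕ) (μ' : ℕ → ℕ) (k : ℕ) : Set (ℕ → ℕ) :=
  {s | Supported r s ∧ (∀ i, 1 ≤ i → i ≤ r → s i ≤ μ' i) ∧
    (∑ i ∈ Finset.Icc 1 r, s i) = k}

/- ### Sums over boxes -/

/-- The functions supported on `{1,…,n}` with `d i ≤ ν i` there. -/
def box (ν : ℕ → ℕ) : ℕ → Finset (ℕ → ℕ)
  | 0 => {0}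
  | n + 1 => (box ν n ×ˢ range (ν (n + 1) + 1)).image fun p => Function.update p.1 (n + 1) p.2

theorem mem_box (ν : ℕ → ℕ) (n : ℕ) (d : ℕ → ℕ) :
    d ∈ box ν n ↔ Supported n d ∧ ∀ i, 1 ≤ i → i ≤ n → d i ≤ ν i := by
  induction n generalizing d with
  | zero =>
    simp only [box, mem_singleton, Supported]
    constructor
    · rintro rfl
      exact ⟨fun _ _ => rfl, fun _ _ _ => Nat.zero_le _⟩
    · rintro ⟨h, -⟩
      funext j
      exact h j (by omega)
  | succ n ih =>
    simp only [box, mem_image, mem_product, Prod.exists, mem_range, ih, Supported]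
    constructor
    · rintro ⟨e, a, ⟨⟨h0, h1⟩, h2⟩, rfl⟩
      refine ⟨fun j hj => ?_, fun i hi hi' => ?_⟩
      · rw [Function.update_of_ne (by omega)]
        exact h0 j (by omega)
      · by_cases hin : i = n + 1
        · subst hin
          simp only [Function.update_self]
          omega
        · rw [Function.update_of_ne hin]
          exact h1 i hi (by omega)
    · rintro ⟨h0, h1⟩
      refine ⟨Function.update d (n + 1) 0, d (n + 1),
        ⟨⟨fun j hj => ?_, fun i hi hi' => ?_⟩, ?_⟩, ?_⟩
      · by_cases hjn : j = n + 1
        · simp [hjn]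
        · rw [Function.update_of_ne hjn]
          exact h0 j (by omega)
      · rw [Function.update_of_ne (by omega)]
        exact h1 i hi (by omega)
      · have := h1 (n + 1) (by omega) le_rfl
        omega
      · simp

theorem sum_box_succ (ν : ℕ → ℕ) (n : ℕ) (f : (ℕ → ℕ) → RatFunc ℚ) :
    ∑ t ∈ box ν (n + 1), f t
      = ∑ d ∈ box ν n, ∑ a ∈ range (ν (n + 1) + 1), f (Function.update d (n + 1) a) := by
  rw [box, sum_image, sum_product]
  rintro ⟨d, a⟩ hd ⟨e, b⟩ he h
  have hd' := ((mem_box _ _ _).1 (mem_product.1 hd).1).1 (n + 1) (by omega)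
  have he' := ((mem_box _ _ _).1 (mem_product.1 he).1).1 (n + 1) (by omega)
  simp only at h hd' he'
  have hab : a = b := by simpa using congrFun h (n + 1)
  have hde : d = e := by
    funext j
    by_cases hj : j = n + 1
    · rw [hj, hd', he']
    · simpa [hj] using congrFun h j
  rw [hab, hde]

theorem box_congr {ν ν' : ℕ → ℕ} {n : ℕ} (h : ∀ i, 1 ≤ i → i ≤ n → ν i = ν' i) :
    box ν n = box ν' n := by
  ext d
  simp only [mem_box]
  refine and_congr_right fun _ => forall_congr' fun i => ?_
  refine forall_congr' fun hi => forall_congr' fun hi' => ?_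
  rw [h i hi hi']

theorem sum_box_one (ν : ℕ → ℕ) (f : (ℕ → ℕ) → RatFunc ℚ) :
    ∑ t ∈ box ν 1, f t = ∑ a ∈ range (ν 1 + 1), f (Function.update 0 1 a) := by
  rw [sum_box_succ]
  simp [box]

/-- The partial sum `d₁ + ⋯ + dₙ`. -/
def psum (d : ℕ → ℕ) (n : ℕ) : ℕ := ∑ i ∈ Icc 1 n, d i

theorem psum_succ (d : ℕ → ℕ) (n : ℕ) : psum d (n + 1) = psum d n + d (n + 1) :=
  sum_Icc_succ_top (by omega) _

theorem psum_congr {d e : ℕ → ℕ} {n : ℕ} (h : ∀ i, 1 ≤ i → i ≤ n → d i = e i) :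
    psum d n = psum e n :=
  sum_congr rfl fun i hi => h i (mem_Icc.1 hi).1 (mem_Icc.1 hi).2

theorem psum_update {d : ℕ → ℕ} {n m a : ℕ} (h : n < m) :
    psum (Function.update d m a) n = psum d n :=
  psum_congr fun i _ hi => Function.update_of_ne (by omega) _ _

theorem sum_range_two_mul (n : ℕ) (f : ℕ → RatFunc ℚ) :
    ∑ a ∈ range (2 * n), f a = ∑ e ∈ range n, (f (2 * e) + f (2 * e + 1)) := by
  induction n with
  | zero => simp
  | succ n ih =>
    rw [show 2 * (n + 1) = 2 * n + 1 + 1 by ring, sum_range_succ, sum_range_succ, ih,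
      sum_range_succ, add_assoc]

/-- The positions `1,…,2m+1` arranged as `1` followed by the pairs `(i, 2m+3-i)`. -/
theorem prod_Icc_odd_pairs (m : ℕ) (f : ℕ → RatFunc ℚ) :
    ∏ i ∈ Icc 1 (2 * m + 1), f i
      = f 1 * ∏ i ∈ range m, (f (i + 2) * f (2 * m + 1 - i)) := by
  have h : ∏ i ∈ Icc 1 (2 * m + 1), f i = ∏ i ∈ range (m + 1 + m), f (i + 1) := by
    rw [← Ico_add_one_right_eq_Icc, prod_Ico_eq_prod_range]
    refine prod_congr (by congr 1; omega) fun i _ => by rw [add_comm]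
  rw [h, prod_range_add, prod_range_succ', prod_mul_distrib,
    ← prod_range_reflect (fun i => f (m + 1 + i + 1))]
  have h' : ∏ j ∈ range m, f (m + 1 + (m - 1 - j) + 1) = ∏ i ∈ range m, f (2 * m + 1 - i) :=
    prod_congr rfl fun i hi => by
      have := mem_range.1 hi
      congr 1
      omega
  rw [h']
  ring

/- ### Local weights -/

/-- The factor `γ` of an entry with the given decorations. -/
def wt (boxed circled : Prop) : RatFunc ℚ :=
  if boxed then (if circled then 0 else -q⁻¹) else (if circled then 1 else 1 - q⁻¹)

/-- The factor `γ̃` of an entry with the given decorations and parity. -/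
def wtT (boxed circled even : Prop) : RatFunc ℚ :=
  if boxed then (if circled then 0 else if even then -q⁻¹ else x⁻¹)
  else (if circled then 1 else if even then 1 - q⁻¹ else 0)

theorem wtT_of_even {b c e : Prop} (he : e) : wtT b c e = wt b c := by
  simp [wtT, wt, he]

theorem inv_x_mul_inv_x : x⁻¹ * x⁻¹ = q⁻¹ := by
  rw [q, pow_two, mul_inv]

/-- The contribution of coordinate `i + 1` in type B: its own position and the mirror position
of its predecessor. -/
def pairB (μ d : ℕ → ℕ) (i : ℕ) : RatFunc ℚ :=
  wt (d (i + 1) = μ (i + 1)) (d (i + 1) = 0) * wt (d (i + 1) = μ (i + 1)) (d i = 0)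

/-- The type B weight of the first `n + 1` coordinates. -/
def prodB (μ d : ℕ → ℕ) (n : ℕ) : RatFunc ℚ :=
  wt (d 1 = μ 1) (d 1 = 0) * ∏ i ∈ range n, pairB μ d (i + 1)

/-- The contribution of coordinate `i + 1` in type C: its own position and the mirror position
of its predecessor. -/
def pairC (ν s : ℕ → ℕ) (i : ℕ) : RatFunc ℚ :=
  wtT (s (i + 1) = ν (i + 1)) (s (i + 1) = 0) (Even (psum s i)) *
    wtT (s (i + 1) = ν (i + 1)) (s i = 0) (Even (psum s i))

/-- The type C weight of the first `n + 1` coordinates. -/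
def prodC (ν s : ℕ → ℕ) (n : ℕ) : RatFunc ℚ :=
  wt (s 1 = ν 1) (s 1 = 0) * ∏ i ∈ range n, pairC ν s (i + 1)

theorem prodB_succ (μ d : ℕ → ℕ) (n : ℕ) :
    prodB μ d (n + 1) = prodB μ d n * pairB μ d (n + 1) := by
  rw [prodB, prod_range_succ, ← mul_assoc, prodB]

theorem prodC_succ (ν s : ℕ → ℕ) (n : ℕ) :
    prodC ν s (n + 1) = prodC ν s n * pairC ν s (n + 1) := by
  rw [prodC, prod_range_succ, ← mul_assoc, prodC]

theorem prodB_update (μ d : ℕ → ℕ) (n a : ℕ) :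
    prodB μ (Function.update d (n + 2) a) n = prodB μ d n := by
  unfold prodB pairB
  rw [Function.update_of_ne (by omega)]
  refine congrArg _ (prod_congr rfl fun i hi => ?_)
  have := mem_range.1 hi
  rw [Function.update_of_ne (by omega), Function.update_of_ne (by omega)]

theorem prodC_update (ν s : ℕ → ℕ) (n a : ℕ) :
    prodC ν (Function.update s (n + 2) a) n = prodC ν s n := by
  unfold prodC pairC
  rw [Function.update_of_ne (by omega)]
  refine congrArg _ (prod_congr rfl fun i hi => ?_)
  have := mem_range.1 hi
  rw [Function.update_of_ne (by omega), Function.update_of_ne (by omega), psum_update (by omega)]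

theorem prodB_update_succ (μ d : ℕ → ℕ) (n a : ℕ) :
    prodB μ (Function.update d (n + 2) a) (n + 1)
      = prodB μ d n * (wt (a = μ (n + 2)) (a = 0) * wt (a = μ (n + 2)) (d (n + 1) = 0)) := by
  rw [prodB_succ, prodB_update, pairB, Function.update_self, Function.update_of_ne (by omega)]

theorem prodC_update_succ (ν s : ℕ → ℕ) (n a : ℕ) :
    prodC ν (Function.update s (n + 2) a) (n + 1)
      = prodC ν s n * (wtT (a = ν (n + 2)) (a = 0) (Even (psum s (n + 1))) *
          wtT (a = ν (n + 2)) (s (n + 1) = 0) (Even (psum s (n + 1)))) := by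
  rw [prodC_succ, prodC_update, pairC, Function.update_self, Function.update_of_ne (by omega),
    psum_update (by omega)]

theorem psum_update_succ (d : ℕ → ℕ) (n a : ℕ) :
    psum (Function.update d (n + 1) a) (n + 1) = psum d n + a := by
  rw [psum_succ, psum_update (by omega), Function.update_self]

/-- The contribution to type C of the tuples of length `n + 1` with an odd entry: such a tuple
has exactly one odd entry, and every later entry is maximal. A tuple of sum `2m + 1` is
tested against `f m`. -/
def oddPart (μ : ℕ → ℕ) : ℕ → (ℕ → RatFunc ℚ) → RatFunc ℚ
  | 0, f => ∑ a ∈ range (μ 1), (1 - q⁻¹) * f a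
  | n + 1, f =>
    ∑ d ∈ box μ (n + 1), prodB μ d n *
        ∑ a ∈ range (μ (n + 2)),
          (1 - q⁻¹) * wt False (d (n + 1) = 0) * f (psum d (n + 1) + a) +
      oddPart μ n fun m => q⁻¹ * f (m + μ (n + 2))

/-- From an odd partial sum with nonzero last entry only the maximal entry survives. -/
theorem sum_wtT_odd {M : ℕ} (hM : 1 ≤ M) {e : Prop} (he : ¬e) (F : ℕ → RatFunc ℚ) :
    ∑ a ∈ range (M + 1), wtT (a = M) (a = 0) e * wtT (a = M) False e * F a = q⁻¹ * F M := by
  rw [sum_range_succ, sum_eq_zero, zero_add, ← inv_x_mul_inv_x]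
  · simp [wtT, he, show M ≠ 0 by omega]
  · intro a ha
    have : a ≠ M := (mem_range.1 ha).ne
    simp [wtT, he, this]

theorem sum_even_odd (M : ℕ) (F : Prop → Prop → ℕ → RatFunc ℚ) :
    ∑ a ∈ range (2 * M + 1), F (a = 2 * M) (a = 0) a
      = ∑ b ∈ range (M + 1), F (b = M) (b = 0) (2 * b)
        + ∑ a ∈ range M, F False False (2 * a + 1) := by
  have h1 : ∀ e : ℕ, (2 * e = 2 * M) = (e = M) := fun e => propext (by omega)
  have h2 : ∀ e : ℕ, (2 * e = 0) = (e = 0) := fun e => propext (by omega)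
  have h3 : ∀ e : ℕ, (2 * e + 1 = 2 * M) = False := fun e => eq_false (by omega)
  have h4 : ∀ e : ℕ, (2 * e + 1 = 0) = False := fun e => eq_false (by omega)
  rw [sum_range_succ, sum_range_two_mul, sum_add_distrib, sum_range_succ]
  simp only [h1, h2, h3, h4]
  ring

theorem wt_false_false : wt False False = 1 - q⁻¹ := by
  simp [wt]

/-- Splitting the type C sum into the tuples with even entries, which carry the type B
weight, and the others. -/
theorem sum_prodC {μ ν : ℕ → ℕ} {n : ℕ} (hμ : ∀ i, 1 ≤ i → i ≤ n + 1 → 1 ≤ μ i)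
    (hν : ∀ i, 1 ≤ i → i ≤ n + 1 → ν i = 2 * μ i) (F : ℕ → Prop → RatFunc ℚ) :
    ∑ s ∈ box ν (n + 1), prodC ν s n * F (psum s (n + 1)) (s (n + 1) = 0)
      = ∑ d ∈ box μ (n + 1), prodB μ d n * F (2 * psum d (n + 1)) (d (n + 1) = 0)
        + oddPart μ n fun m => F (2 * m + 1) False := by
  induction n generalizing F with
  | zero =>
    have hp : ∀ a : ℕ, psum (Function.update 0 1 a) 1 = a := fun a => by simp [psum]
    rw [sum_box_one, sum_box_one, oddPart, hν 1 le_rfl le_rfl]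
    simp only [prodB, prodC, range_zero, prod_empty, mul_one, zero_add, hp, Function.update_self,
      hν 1 le_rfl le_rfl]
    rw [sum_even_odd (μ 1) fun b c a => wt b c * F a c, wt_false_false]
  | succ n ih =>
    rw [sum_box_succ, sum_box_succ μ (n + 1), oddPart]
    simp only [prodC_update_succ, prodB_update_succ, psum_update_succ, Function.update_self]
    have hC := ih (fun i h h' => hμ i h (by omega)) (fun i h h' => hν i h (by omega))
      (fun S c => ∑ a ∈ range (ν (n + 2) + 1),
        wtT (a = ν (n + 2)) (a = 0) (Even S) * wtT (a = ν (n + 2)) c (Even S) * F (S + a) (a = 0))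
    simp only [mul_sum] at hC ⊢
    simp only [mul_assoc] at hC ⊢
    rw [hC, ← add_assoc, ← sum_add_distrib]
    have hν' : ν (n + 2) = 2 * μ (n + 2) := hν _ (by omega) le_rfl
    have hμ' : 1 ≤ μ (n + 2) := hμ _ (by omega) le_rfl
    congr 1
    · refine sum_congr rfl fun d _ => ?_
      have h := sum_even_odd (μ (n + 2)) fun b c a =>
        wt b c * wt b (d (n + 1) = 0) * F (2 * psum d (n + 1) + a) c
      rw [wt_false_false] at h
      simp only [wtT_of_even (even_two_mul _), hν', ← mul_sum]
      simp only [mul_assoc] at h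
      rw [h, mul_add]
      simp only [mul_sum, mul_add, add_assoc]
    · congr 1
      funext m
      have h := sum_wtT_odd (M := ν (n + 2)) (by omega) (e := Even (2 * m + 1))
        (by simp) (fun a => F (2 * m + 1 + a) (a = 0))
      simp only [mul_assoc] at h
      rw [h, hν', show 2 * m + 1 + 2 * μ (n + 2) = 2 * (m + μ (n + 2)) + 1 by ring]
      congr 2
      exact propext (by simp; omega)

theorem sum_wt_first {M : ℕ} (hM : 1 ≤ M) (T : ℕ → RatFunc ℚ) :
    ∑ b ∈ range (M + 1), wt (b = M) (b = 0) * T b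
      = ∑ a ∈ range M, (T a - q⁻¹ * T (a + 1)) := by
  obtain ⟨M, rfl⟩ := Nat.exists_eq_add_of_le' hM
  rw [sum_sub_distrib, sum_range_succ', sum_range_succ, sum_range_succ', sum_range_succ _ M]
  have h : ∑ k ∈ range M, wt (k + 1 = M + 1) (k + 1 = 0) * T (k + 1)
      = ∑ k ∈ range M, T (k + 1) - ∑ k ∈ range M, q⁻¹ * T (k + 1) := by
    rw [← sum_sub_distrib]
    refine sum_congr rfl fun k hk => ?_
    have : k ≠ M := (mem_range.1 hk).ne
    simp only [wt, add_left_inj, this, if_false, Nat.succ_ne_zero]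
    ring
  rw [h]
  simp [wt]
  ring

theorem sum_wt_wt {M : ℕ} (hM : 1 ≤ M) (c : Prop) (T : ℕ → RatFunc ℚ) :
    ∑ b ∈ range (M + 1), wt (b = M) (b = 0) * wt (b = M) c * T b
      = ∑ a ∈ range M, wt False c * (T a - q⁻¹ * T (a + 1)) + q⁻¹ * T M := by
  rw [← mul_sum, ← sum_wt_first hM, sum_range_succ, sum_range_succ, mul_add, mul_sum, add_assoc]
  congr 1
  · refine sum_congr rfl fun b hb => ?_
    have : b ≠ M := (mem_range.1 hb).ne
    simp only [this]
    ring
  · by_cases hc : c <;> simp [wt, hc, show M ≠ 0 by omega]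
    ring

theorem sum_geometric_shift {N : ℕ} {h : ℕ → RatFunc ℚ} (hN : ∀ m, N ≤ m → h m = 0) (s : ℕ) :
    h s = ∑ e ∈ range N, q⁻¹ ^ e * h (s + e)
      - q⁻¹ * ∑ e ∈ range N, q⁻¹ ^ e * h (s + 1 + e) := by
  have h1 := sum_range_succ (fun e => q⁻¹ ^ e * h (s + e)) N
  rw [sum_range_succ', hN (s + N) (by omega)] at h1
  simp only [pow_zero, add_zero, mul_zero, one_mul] at h1
  rw [← h1, mul_sum]
  have h2 : ∑ k ∈ range N, q⁻¹ ^ (k + 1) * h (s + (k + 1))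
      = ∑ e ∈ range N, q⁻¹ * (q⁻¹ ^ e * h (s + 1 + e)) :=
    sum_congr rfl fun k _ => by
      rw [show s + (k + 1) = s + 1 + k by ring]
      ring
  rw [h2]
  ring

/-- The type B tuples with last entry beyond `μ_r` account for `oddPart`. -/
theorem sum_prodB_geometric {μ : ℕ → ℕ} {n N : ℕ} (hμ : ∀ i, 1 ≤ i → i ≤ n + 1 → 1 ≤ μ i)
    {h : ℕ → RatFunc ℚ} (hN : ∀ m, N ≤ m → h m = 0) :
    ∑ d ∈ box μ (n + 1), prodB μ d n *
        ((1 - q⁻¹) * ∑ e ∈ range N, q⁻¹ ^ e * h (psum d (n + 1) + e)) = oddPart μ n h := by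
  induction n generalizing h with
  | zero =>
    have hp : ∀ a : ℕ, psum (Function.update 0 1 a) 1 = a := fun a => by simp [psum]
    rw [sum_box_one, oddPart]
    simp only [prodB, range_zero, prod_empty, mul_one, zero_add, hp, Function.update_self]
    have := sum_wt_first (hμ 1 le_rfl le_rfl)
      (fun b => ∑ e ∈ range N, q⁻¹ ^ e * h (b + e))
    simp only [← sum_geometric_shift hN] at this
    rw [← mul_sum, ← this, mul_sum]
    exact sum_congr rfl fun _ _ => by ring
  | succ n ih =>
    rw [sum_box_succ, oddPart, ← ih (fun i h1 h2 => hμ i h1 (by omega))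
      (h := fun m => q⁻¹ * h (m + μ (n + 2)))
      (fun m hm => by rw [hN _ (by omega), mul_zero]), ← sum_add_distrib]
    refine sum_congr rfl fun d _ => ?_
    simp only [prodB_update_succ, psum_update_succ]
    have key := sum_wt_wt (hμ (n + 2) (by omega) le_rfl) (d (n + 1) = 0)
      (fun b => ∑ e ∈ range N, q⁻¹ ^ e * h (psum d (n + 1) + b + e))
    simp only [← add_assoc, ← sum_geometric_shift hN] at key
    calc _ = prodB μ d n * (1 - q⁻¹) * ∑ b ∈ range (μ (n + 2) + 1),
          wt (b = μ (n + 2)) (b = 0) * wt (b = μ (n + 2)) (d (n + 1) = 0) *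
            ∑ e ∈ range N, q⁻¹ ^ e * h (psum d (n + 1) + b + e) := by
          rw [mul_sum]
          exact sum_congr rfl fun _ _ => by ring
      _ = _ := by
          rw [key]
          have h1 : ∑ e ∈ range N, q⁻¹ ^ e * (q⁻¹ * h (psum d (n + 1) + e + μ (n + 2)))
              = q⁻¹ * ∑ e ∈ range N, q⁻¹ ^ e * h (psum d (n + 1) + μ (n + 2) + e) := by
            rw [mul_sum]
            exact sum_congr rfl fun e _ => by rw [add_right_comm]; ring
          simp only [h1, mul_assoc, ← mul_sum]
          ring

/- ### The weights of the arrays as products over coordinates -/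

theorem gam_eq_wt {r i : ℕ} (hi : i ≤ r) (μ d : ℕ → ℕ) :
    gam r μ d i = wt (d i = μ i) (d i = 0) := by
  have hB : Boxed r μ d i = (d i = μ i) := by rw [Boxed, if_pos hi]
  have hC : Circled r d i = (d i = 0) := by rw [Circled, Dd, if_pos hi]
  rw [gam, hB, hC, wt]

theorem gam_mirror {r i : ℕ} (h1 : 1 ≤ i) (hi : i < r) (μ d : ℕ → ℕ) :
    gam r μ d (2 * r - i) = wt (d (i + 1) = μ (i + 1)) (d i = 0) := by
  have hr : ¬ 2 * r - i ≤ r := by omega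
  have hB : Boxed r μ d (2 * r - i) = (d (i + 1) = μ (i + 1)) := by
    rw [Boxed, if_neg hr]
    split_ifs with h
    · rw [show i + 1 = r by omega]
    · rw [show 2 * r - (2 * r - i) + 1 = i + 1 by omega]
  have hC : Circled r d (2 * r - i) = (d i = 0) := by
    rw [Circled, Dd, if_neg hr, show 2 * r - (2 * r - i) = i by omega]
  rw [gam, hB, hC, wt]

theorem gam_pair {n i : ℕ} (hi : i < n) (μ d : ℕ → ℕ) :
    gam (n + 1) μ d (i + 2) * gam (n + 1) μ d (2 * n + 1 - i) = pairB μ d (i + 1) := by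
  rw [gam_eq_wt (by omega), show 2 * n + 1 - i = 2 * (n + 1) - (i + 1) by omega,
    gam_mirror (by omega) (by omega), pairB]

theorem GDelta_eq_prodB (n : ℕ) (μ d : ℕ → ℕ) : GDelta (n + 1) μ d = prodB μ d n := by
  rw [GDelta, show 2 * (n + 1) - 1 = 2 * n + 1 by omega, prod_Icc_odd_pairs, prodB,
    gam_eq_wt (by omega)]
  exact congrArg _ (prod_congr rfl fun i hi => gam_pair (mem_range.1 hi) μ d)

theorem prod_erase_gam (n : ℕ) (μ d : ℕ → ℕ) :
    ∏ i ∈ ((Icc 1 (2 * (n + 2) - 1)).erase (n + 2)).erase (n + 2 + 1), gam (n + 2) μ d i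
      = prodB μ d n := by
  have h : ∏ i ∈ ((Icc 1 (2 * (n + 2) - 1)).erase (n + 2)).erase (n + 2 + 1), gam (n + 2) μ d i
      = ∏ i ∈ Icc 1 (2 * (n + 1) + 1),
          if i = n + 2 ∨ i = n + 3 then 1 else gam (n + 2) μ d i := by
    rw [show 2 * (n + 2) - 1 = 2 * (n + 1) + 1 by omega]
    have hs : ((Icc 1 (2 * (n + 1) + 1)).erase (n + 2)).erase (n + 2 + 1)
        = (Icc 1 (2 * (n + 1) + 1)).filter fun i => ¬(i = n + 2 ∨ i = n + 3) := by
      ext i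
      simp only [mem_erase, mem_filter, mem_Icc]
      omega
    rw [hs, prod_filter]
    refine prod_congr rfl fun i _ => ?_
    by_cases hi : i = n + 2 ∨ i = n + 3 <;> simp [hi]
  rw [h, prod_Icc_odd_pairs, prod_range_succ, if_neg (by omega), if_pos (Or.inl rfl),
    if_pos (by omega), mul_one, mul_one, prodB, gam_eq_wt (by omega)]
  refine congrArg _ (prod_congr rfl fun i hi => ?_)
  have hi' := mem_range.1 hi
  rw [if_neg (by omega), if_neg (by omega), gam_pair (by omega)]

theorem even_bArr {r j : ℕ} (hj : j ≤ r) (b : ℕ → ℕ) :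
    Even (bArr r b j) ↔ Even (psum b (j - 1)) := by
  have hle : psum b (j - 1) ≤ 2 * psum b r := by
    have : psum b (j - 1) ≤ psum b r :=
      sum_le_sum_of_subset (Icc_subset_Icc le_rfl (by omega))
    omega
  rw [bArr, if_pos hj]
  change Even (2 * psum b r - psum b (j - 1)) ↔ _
  rw [Nat.even_sub hle]
  simp

theorem gamT_eq_wtT {r i : ℕ} (hi : i ≤ r) (ν s : ℕ → ℕ) :
    gamT r ν s i = wtT (s i = ν i) (s i = 0) (Even (psum s (i - 1))) := by
  have hB : BoxedC r ν s i = (s i = ν i) := by rw [BoxedC, if_pos hi]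
  have hC : CircledC r s i = (s i = 0) := by rw [CircledC, if_pos hi]
  simp only [gamT, hB, hC, wtT, even_bArr hi]
  split_ifs <;> rfl

theorem gamT_mirror {r i : ℕ} (hi : i < r) (ν s : ℕ → ℕ) :
    gamT r ν s (2 * r - i) = wtT (s (i + 1) = ν (i + 1)) (s i = 0) (Even (psum s i)) := by
  have hr : ¬ 2 * r - i ≤ r := by omega
  have hi' : 2 * r - (2 * r - i) = i := by omega
  have hB : BoxedC r ν s (2 * r - i) = (s (i + 1) = ν (i + 1)) := by
    rw [BoxedC, if_neg hr, hi']
  have hC : CircledC r s (2 * r - i) = (s i = 0) := by rw [CircledC, if_neg hr, hi']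
  have hA : bArr r s (2 * r - i) = psum s i := by rw [bArr, if_neg hr, hi', psum]
  simp only [gamT, hB, hC, hA, wtT]
  split_ifs <;> rfl

theorem GDeltaC_eq_prodC (n : ℕ) (ν s : ℕ → ℕ) : GDeltaC (n + 1) ν s = prodC ν s n := by
  rw [GDeltaC, show 2 * (n + 1) - 1 = 2 * n + 1 by omega, prod_Icc_odd_pairs, prodC,
    gamT_eq_wtT (by omega), wtT_of_even (by simp [psum])]
  refine congrArg _ (prod_congr rfl fun i hi => ?_)
  have hi' := mem_range.1 hi
  rw [gamT_eq_wtT (by omega), show 2 * n + 1 - i = 2 * (n + 1) - (i + 1) by omega,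
    gamT_mirror (by omega), pairC]
  rfl

/- ### The two sides -/

/-- The common part of the two sides: the type B sum over tuples with `d_r ≤ μ_r`. -/
def evenPart (μ : ℕ → ℕ) (n k : ℕ) : RatFunc ℚ :=
  ∑ d ∈ box μ (n + 1), prodB μ d n * ∑ a ∈ range (μ (n + 2) + 1),
    wt (a = μ (n + 2)) (a = 0) * wt (a = μ (n + 2)) (d (n + 1) = 0) *
      if 2 * psum d (n + 1) + a = k then 1 else 0

theorem finsum_OmegaLeA {μ : ℕ → ℕ} {n : ℕ} (hμ : ∀ i, 1 ≤ i → i ≤ n + 2 → 1 ≤ μ i) (k : ℕ) :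
    ∑ᶠ s ∈ OmegaLeA (n + 2) (ups (n + 2) μ) k, GDeltaC (n + 2) (ups (n + 2) μ) s
      = evenPart μ n k + oddPart μ n fun m =>
          q⁻¹ * if 2 * m + 1 + μ (n + 2) = k then 1 else 0 := by
  have hΩ : OmegaLeA (n + 2) (ups (n + 2) μ) k
      = ↑((box (ups (n + 2) μ) (n + 2)).filter fun s => psum s (n + 2) = k) := by
    ext s
    simp only [OmegaLeA, Set.mem_ofPred_eq, mem_coe, mem_filter, mem_box, and_assoc]
    rfl
  have hlast : ups (n + 2) μ (n + 2) = μ (n + 2) := by simp [ups]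
  rw [hΩ, finsum_mem_coe_finset, sum_filter, sum_box_succ]
  have hC := sum_prodC (μ := μ) (ν := ups (n + 2) μ) (n := n)
    (fun i h h' => hμ i h (by omega)) (fun i h h' => by rw [ups, if_pos (by omega)])
    (fun S c => ∑ a ∈ range (μ (n + 2) + 1),
      wtT (a = μ (n + 2)) (a = 0) (Even S) * wtT (a = μ (n + 2)) c (Even S) *
        if S + a = k then 1 else 0)
  simp only [sum_wtT_odd (hμ (n + 2) (by omega) le_rfl)
    (show ¬Even (2 * _ + 1) by simp), wtT_of_even (even_two_mul _)] at hC
  rw [evenPart, ← hC]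
  refine sum_congr rfl fun s _ => ?_
  rw [mul_sum, hlast]
  refine sum_congr rfl fun a _ => ?_
  rw [GDeltaC_eq_prodC, prodC_update_succ, psum_update_succ, hlast]
  by_cases hk : psum s (n + 1) + a = k
  · simp only [hk, if_true, mul_one]
  · simp only [hk, if_false, mul_zero]

theorem finsum_OmegaB {μ : ℕ → ℕ} {n : ℕ} (hμ : ∀ i, 1 ≤ i → i ≤ n + 2 → 1 ≤ μ i) (k : ℕ) :
    ∑ᶠ t ∈ OmegaB (n + 2) μ k, Gres (n + 2) μ t
      = evenPart μ n k + oddPart μ n fun m =>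
          q⁻¹ * if 2 * m + 1 + μ (n + 2) = k then 1 else 0 := by
  set ν := Function.update μ (n + 2) (μ (n + 2) + 2 * k)
  have hνμ : ∀ i, 1 ≤ i → i ≤ n + 1 → ν i = μ i := fun i _ hi =>
    Function.update_of_ne (by omega) _ _
  have hνr : ν (n + 2) = μ (n + 2) + 2 * k := Function.update_self _ _ _
  have hΩ : OmegaB (n + 2) μ k
      = ↑((box ν (n + 2)).filter fun t => t (n + 2) + 2 * psum t (n + 1) = k) := by
    ext t
    simp only [OmegaB, Set.mem_ofPred_eq, mem_coe, mem_filter, mem_box, and_assoc]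
    refine and_congr_right fun _ => ⟨fun ⟨h1, h2⟩ => ⟨fun i hi hi' => ?_, h2⟩,
      fun ⟨h1, h2⟩ => ⟨fun i hi hi' => ?_, h2⟩⟩
    · by_cases hin : i = n + 2
      · subst hin
        omega
      · rw [hνμ i hi (by omega)]
        exact h1 i hi (by omega)
    · rw [← hνμ i hi (by omega)]
      exact h1 i hi (by omega)
  have hvanish : ∀ m, k ≤ m →
      q⁻¹ * (if 2 * m + 1 + μ (n + 2) = k then 1 else 0 : RatFunc ℚ) = 0 := fun m hm => by
    rw [if_neg (by omega), mul_zero]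
  rw [hΩ, finsum_mem_coe_finset, sum_filter, sum_box_succ, box_congr hνμ, evenPart,
    ← sum_prodB_geometric (fun i h h' => hμ i h (by omega)) hvanish, ← sum_add_distrib, hνr]
  refine sum_congr rfl fun d _ => ?_
  rw [show μ (n + 2) + 2 * k + 1 = μ (n + 2) + 1 + 2 * k by ring, sum_range_add]
  simp only [Function.update_self, psum_update (show n + 1 < n + 1 + 1 by omega)]
  congr 1
  · rw [mul_sum]
    refine sum_congr rfl fun a ha => ?_
    have ha' := mem_range.1 ha
    rw [Gres, Function.update_self, if_pos (show a ≤ μ (n + 2) by omega), GDelta_eq_prodB,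
      prodB_update_succ, add_comm a]
    by_cases hk : 2 * psum d (n + 1) + a = k
    · simp only [hk, if_true, mul_one]
    · simp only [hk, if_false, mul_zero]
  · rw [sum_range_two_mul, ← mul_assoc, mul_sum]
    refine sum_congr rfl fun e _ => ?_
    have hodd : Odd (μ (n + 2) + 1 + 2 * e - μ (n + 2)) := ⟨e, by omega⟩
    have heven : ¬Odd (μ (n + 2) + 1 + (2 * e + 1) - μ (n + 2)) := by
      rw [Nat.not_odd_iff_even]
      exact ⟨e + 1, by omega⟩
    have hexp : (μ (n + 2) + 1 + 2 * e - μ (n + 2) + 1) / 2 = e + 1 := by omega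
    simp only [Gres, Function.update_self]
    rw [if_neg (show ¬ μ (n + 2) + 1 + 2 * e ≤ μ (n + 2) by omega),
      if_neg (show ¬ μ (n + 2) + 1 + (2 * e + 1) ≤ μ (n + 2) by omega), if_pos hodd, if_neg heven,
      ite_self, add_zero, hexp, prod_erase_gam, prodB_update]
    have hiff : μ (n + 2) + 1 + 2 * e + 2 * psum d (n + 1) = k ↔
        2 * (psum d (n + 1) + e) + 1 + μ (n + 2) = k := by omega
    by_cases hk : 2 * (psum d (n + 1) + e) + 1 + μ (n + 2) = k
    · simp only [hiff, hk, if_true, inv_pow, pow_succ, mul_inv]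
      ring
    · simp only [hiff, hk, if_false, mul_zero]

/-- For every `k ≥ 0`: `Σ_{t ∈ Ω_B(μ,k)} G(t) = Σ_{s ∈ Ω^≤_A(μ',k)} G_{Δ_C}(s)`,
as an identity in `ℚ(q^{1/2})`. -/
theorem stmt13 (r : ℕ) (hr : 2 ≤ r) (μ : ℕ → ℕ)
    (hμ : ∀ i, 1 ≤ i → i ≤ r → 1 ≤ μ i) (k : ℕ) :
    ∑ᶠ t ∈ OmegaB r μ k, Gres r μ t
      = ∑ᶠ s ∈ OmegaLeA r (ups r μ) k, GDeltaC r (ups r μ) s := by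
  obtain ⟨n, rfl⟩ := Nat.exists_eq_add_of_le' hr
  rw [finsum_OmegaB hμ, finsum_OmegaLeA hμ]

end Stmt13
end
end

section
/- Let r ≥ 2 and let R = (R₁,…,R_{2r}) ∈ ℤ^{2r} with gcd(R₁,…,R_{2r}) = 1. Then there exist g₁, g₃ ∈ SL_r(ℤ) and g₂ ∈ SL₂(ℤ) such that the product i₁(g₁) · i₂(g₂) · i₃(g₃) is an element of Sp_{2r}(ℤ) whose bottom (2r-th) row equals R. -/
open Finset
open scoped Classical

noncomputable section

namespace Stmt19

/-- The matrix `J_{2r}` with `(i, 2r+1−i)` entry `(−1)^i` (1-based), i.e.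
(0-based) `(i, 2r−1−i)` entry `(−1)^{i+1}`, and all other entries `0`. -/
def Jmat (r : ℕ) : Matrix (Fin (2 * r)) (Fin (2 * r)) ℤ :=
  Matrix.of fun i j =>
    if (i : ℕ) + (j : ℕ) = 2 * r - 1 then (-1 : ℤ) ^ ((i : ℕ) + 1) else 0

/-- `g ∈ Sp_{2r}(ℤ)`: `gᵀ J_{2r} g = J_{2r}`. -/
def IsSymplectic (r : ℕ) (M : Matrix (Fin (2 * r)) (Fin (2 * r)) ℤ) : Prop :=
  M.transpose * Jmat r * M = Jmat r

/-- The embedding `i₂ : SL₂ → Sp_{2r}`: the entries of `g₂` are placed in the four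
corners, the identity in the central `(2r−2)×(2r−2)` block, and zeros elsewhere. -/
def i2mat (r : ℕ) (g : Matrix (Fin 2) (Fin 2) ℤ) :
    Matrix (Fin (2 * r)) (Fin (2 * r)) ℤ :=
  Matrix.of fun i j =>
    if (i : ℕ) = 0 ∧ (j : ℕ) = 0 then g 0 0
    else if (i : ℕ) = 0 ∧ (j : ℕ) = 2 * r - 1 then g 0 1
    else if (i : ℕ) = 2 * r - 1 ∧ (j : ℕ) = 0 then g 1 0
    else if (i : ℕ) = 2 * r - 1 ∧ (j : ℕ) = 2 * r - 1 then g 1 1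
    else if i = j ∧ 1 ≤ (i : ℕ) ∧ (i : ℕ) ≤ 2 * r - 2 then 1
    else 0

/-- `M₃ = i₃(g₃) = diag(g₃', g₃)`: block diagonal with lower-right `r×r` block `g₃`,
the upper-left block `g₃'` being uniquely determined by symplecticity. -/
def IsI3Of (r : ℕ) (g : Matrix (Fin r) (Fin r) ℤ)
    (M : Matrix (Fin (2 * r)) (Fin (2 * r)) ℤ) : Prop :=
  IsSymplectic r M ∧
  (∀ i j : Fin (2 * r), ∀ hi : r ≤ (i : ℕ), ∀ hj : r ≤ (j : ℕ),
    M i j = g ⟨(i : ℕ) - r, by have := i.isLt; omega⟩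
              ⟨(j : ℕ) - r, by have := j.isLt; omega⟩) ∧
  (∀ i j : Fin (2 * r),
    (((i : ℕ) < r ∧ r ≤ (j : ℕ)) ∨ ((j : ℕ) < r ∧ r ≤ (i : ℕ))) → M i j = 0)

/-- `M₁ = i₁(g₁)`: for `g₁ = (g v; w a)` in block form (with `g` of size
`(r−1)×(r−1)`), `M₁` is the symplectic matrix with block pattern (block sizes
`1, r−1, r−1, 1`): `[[a', 0, w', 0], [0, g, 0, v], [v', 0, g', 0], [0, w, 0, a]]`,
the primed blocks being uniquely determined by symplecticity. -/
def IsI1Of (r : ℕ) (hr : 2 ≤ r) (g : Matrix (Fin r) (Fin r) ℤ)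
    (M : Matrix (Fin (2 * r)) (Fin (2 * r)) ℤ) : Prop :=
  IsSymplectic r M ∧
  -- the `g` block
  (∀ i j : ℕ, ∀ hi : i < r - 1, ∀ hj : j < r - 1,
    M ⟨1 + i, by omega⟩ ⟨1 + j, by omega⟩ = g ⟨i, by omega⟩ ⟨j, by omega⟩) ∧
  -- the `v` block
  (∀ i : ℕ, ∀ hi : i < r - 1,
    M ⟨1 + i, by omega⟩ ⟨2 * r - 1, by omega⟩ = g ⟨i, by omega⟩ ⟨r - 1, by omega⟩) ∧
  -- the `w` block
  (∀ j : ℕ, ∀ hj : j < r - 1,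
    M ⟨2 * r - 1, by omega⟩ ⟨1 + j, by omega⟩ = g ⟨r - 1, by omega⟩ ⟨j, by omega⟩) ∧
  -- the `a` entry
  (M ⟨2 * r - 1, by omega⟩ ⟨2 * r - 1, by omega⟩ = g ⟨r - 1, by omega⟩ ⟨r - 1, by omega⟩) ∧
  -- zero blocks in the first row
  (∀ j : ℕ, ∀ hj : 1 ≤ j ∧ j ≤ r - 1, M ⟨0, by omega⟩ ⟨j, by omega⟩ = 0) ∧
  (M ⟨0, by omega⟩ ⟨2 * r - 1, by omega⟩ = 0) ∧
  -- zero blocks in rows `1,…,r−1`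
  (∀ i : ℕ, ∀ hi : 1 ≤ i ∧ i ≤ r - 1,
    M ⟨i, by omega⟩ ⟨0, by omega⟩ = 0 ∧
    ∀ j : ℕ, ∀ hj : r ≤ j ∧ j ≤ 2 * r - 2, M ⟨i, by omega⟩ ⟨j, by omega⟩ = 0) ∧
  -- zero blocks in rows `r,…,2r−2`
  (∀ i : ℕ, ∀ hi : r ≤ i ∧ i ≤ 2 * r - 2,
    (∀ j : ℕ, ∀ hj : 1 ≤ j ∧ j ≤ r - 1, M ⟨i, by omega⟩ ⟨j, by omega⟩ = 0) ∧
    M ⟨i, by omega⟩ ⟨2 * r - 1, by omega⟩ = 0) ∧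
  -- zero blocks in the last row
  (M ⟨2 * r - 1, by omega⟩ ⟨0, by omega⟩ = 0) ∧
  (∀ j : ℕ, ∀ hj : r ≤ j ∧ j ≤ 2 * r - 2, M ⟨2 * r - 1, by omega⟩ ⟨j, by omega⟩ = 0)

section RowReduction

variable {n : Type*} [Fintype n] [DecidableEq n]

/-- Two integer row vectors are related if some matrix of determinant one takes the first to
the second by right multiplication. -/
def SLRelated (v w : n → ℤ) : Prop :=
  ∃ g : Matrix n n ℤ, g.det = 1 ∧ Matrix.vecMul v g = w

theorem SLRelated.refl (v : n → ℤ) : SLRelated v v :=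
  ⟨1, Matrix.det_one, Matrix.vecMul_one v⟩

theorem SLRelated.trans {u v w : n → ℤ} (huv : SLRelated u v) (hvw : SLRelated v w) :
    SLRelated u w := by
  obtain ⟨g, hg, rfl⟩ := huv
  obtain ⟨h, hh, rfl⟩ := hvw
  exact ⟨g * h, by rw [Matrix.det_mul, hg, hh, one_mul], by rw [Matrix.vecMul_vecMul]⟩

theorem SLRelated.update_add_mul (v : n → ℤ) {i j : n} (hij : i ≠ j) (c : ℤ) :
    SLRelated v (Function.update v j (v j + c * v i)) := by
  refine ⟨Matrix.transvection i j c, Matrix.det_transvection_of_ne i j hij c, ?_⟩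
  ext k
  rw [Matrix.transvection, Matrix.vecMul_add, Matrix.vecMul_one, Pi.add_apply, Matrix.vecMul,
    dotProduct]
  by_cases hk : k = j
  · subst hk
    simp [Matrix.single_apply, mul_comm]
  · simp [hk, Ne.symm hk]

/-- Euclid's algorithm on two coordinates. -/
theorem SLRelated.exists_eq_zero {i j : n} (hij : i ≠ j) (v : n → ℤ) :
    ∃ w, SLRelated v w ∧ w i = 0 ∧ ∀ k, k ≠ i → k ≠ j → w k = v k := by
  induction hN : (v i).natAbs + (v j).natAbs using Nat.strong_induction_on generalizing v with
  | _ N ih =>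
  by_cases hi : v i = 0
  · exact ⟨v, .refl v, hi, fun _ _ _ => rfl⟩
  by_cases hj : v j = 0
  · refine ⟨_, (SLRelated.update_add_mul v hij 1).trans
      (SLRelated.update_add_mul _ hij.symm (-1)), ?_, ?_⟩
    · simp [hij, hj]
    · intro k hki hkj
      simp [hki, hkj]
  rcases le_total (v i).natAbs (v j).natAbs with hle | hle
  · obtain ⟨w, hw, hwi, hwk⟩ := ih _ (by
      have h₁ : (v j % v i).natAbs < (v i).natAbs := by
        have := Int.emod_nonneg (v j) hi
        have := Int.emod_lt_abs (v j) hi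
        rw [Int.abs_eq_natAbs] at this
        omega
      have h₂ : v j + -(v j / v i) * v i = v j % v i := by
        rw [Int.emod_def]; ring
      simp only [Function.update_self, Function.update_of_ne hij, h₂]
      omega) (Function.update v j (v j + -(v j / v i) * v i)) rfl
    refine ⟨w, (SLRelated.update_add_mul v hij _).trans hw, hwi, fun k hki hkj => ?_⟩
    rw [hwk k hki hkj, Function.update_of_ne hkj]
  · obtain ⟨w, hw, hwi, hwk⟩ := ih _ (by
      have h₁ : (v i % v j).natAbs < (v j).natAbs := by
        have := Int.emod_nonneg (v i) hj
        have := Int.emod_lt_abs (v i) hj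
        rw [Int.abs_eq_natAbs] at this
        omega
      have h₂ : v i + -(v i / v j) * v j = v i % v j := by
        rw [Int.emod_def]; ring
      simp only [Function.update_self, Function.update_of_ne hij.symm, h₂]
      omega) (Function.update v i (v i + -(v i / v j) * v j)) rfl
    refine ⟨w, (SLRelated.update_add_mul v hij.symm _).trans hw, hwi, fun k hki hkj => ?_⟩
    rw [hwk k hki hkj, Function.update_of_ne hki]

theorem SLRelated.exists_eq_zero_on (l : n) (v : n → ℤ) (s : Finset n) (hl : l ∉ s) :
    ∃ w, SLRelated v w ∧ ∀ i ∈ s, w i = 0 := by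
  induction s using Finset.induction_on with
  | empty => exact ⟨v, .refl v, by simp⟩
  | insert i s hi ih =>
    rw [Finset.mem_insert, not_or] at hl
    obtain ⟨w, hw, hws⟩ := ih hl.2
    obtain ⟨x, hx, hxi, hxk⟩ := SLRelated.exists_eq_zero (Ne.symm hl.1) w
    refine ⟨x, hw.trans hx, fun k hk => ?_⟩
    rcases Finset.mem_insert.1 hk with rfl | hk
    · exact hxi
    · rw [hxk k (fun h => hi (h ▸ hk)) (fun h => hl.2 (h ▸ hk)), hws k hk]

/-- Every integer vector is a multiple of a given row of some matrix of determinant one. -/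
theorem exists_det_eq_one_smul_row (l : n) (v : n → ℤ) :
    ∃ (m : ℤ) (h : Matrix n n ℤ), h.det = 1 ∧ v = m • h l := by
  obtain ⟨w, ⟨g, hg, hgw⟩, hw⟩ :=
    SLRelated.exists_eq_zero_on l v (Finset.univ.erase l) (Finset.notMem_erase l _)
  have hw' : w = Pi.single l (w l) := by
    ext i
    by_cases hi : i = l
    · subst hi; simp
    · rw [Pi.single_eq_of_ne hi, hw i (by simp [hi])]
  have hunit : IsUnit g.det := by simp [hg]
  refine ⟨w l, g⁻¹, by rw [Matrix.det_nonsing_inv, hg, Ring.inverse_one], ?_⟩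
  calc v = Matrix.vecMul w g⁻¹ := by
        rw [← hgw, Matrix.vecMul_vecMul, Matrix.mul_nonsing_inv _ hunit, Matrix.vecMul_one]
    _ = w l • g⁻¹ l := by
        rw [hw', Matrix.single_vecMul]
        simp
        rfl

/-- A primitive integer vector of length at least two is a row of a matrix of determinant
one. -/
theorem exists_det_eq_one_row_eq {l i : n} (hil : i ≠ l) (v : n → ℤ)
    (hv : ∀ d : ℤ, (∀ j, d ∣ v j) → IsUnit d) :
    ∃ h : Matrix n n ℤ, h.det = 1 ∧ h l = v := by
  obtain ⟨m, h, hh, rfl⟩ := exists_det_eq_one_smul_row l v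
  rcases Int.isUnit_iff.1 (hv m fun j => ⟨h l j, rfl⟩) with rfl | rfl
  · exact ⟨h, hh, by simp⟩
  · refine ⟨(h.updateRow l (-1 • h l)).updateRow i (-1 • h i), ?_, ?_⟩
    · have hrow : h i = (h.updateRow l (-1 • h l)) i := by
        rw [Matrix.updateRow_ne hil]
      rw [Matrix.det_updateRow_smul, hrow, Matrix.updateRow_eq_self,
        Matrix.det_updateRow_smul, Matrix.updateRow_eq_self, hh]
      norm_num
    · rw [Matrix.updateRow_ne hil.symm, Matrix.updateRow_self]

end RowReduction

/-- If `e` selects one index out of each pair `{i, 2r-1-i}`, every invertible matrix on the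
selected coordinates extends to a symplectic matrix preserving both the selected coordinates
and the complementary ones. -/
theorem exists_isSymplectic_of_polarization {r : ℕ} (e : Fin r → Fin (2 * r))
    (he : Function.Injective e) (hrev : ∀ i j, e i ≠ (e j).rev)
    (g k : Matrix (Fin r) (Fin r) ℤ) (hkg : k * g = 1) :
    ∃ M N : Matrix (Fin (2 * r)) (Fin (2 * r)) ℤ,
      IsSymplectic r M ∧ N * M = 1 ∧
      (∀ i j, M (e i) (e j) = g i j) ∧ (∀ i j, M (e i) (e j).rev = 0) ∧
      (∀ i j, M (e i).rev (e j) = 0) ∧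
      ∀ (v : Fin (2 * r) → ℤ) (j : Fin r),
        Matrix.vecMul v N (e j) = Matrix.vecMul (v ∘ e) k j := by
  let f : Fin r ⊕ Fin r → Fin (2 * r) := Sum.elim e (fun i => (e i).rev)
  have hf : Function.Bijective f := by
    rw [Fintype.bijective_iff_injective_and_card]
    refine ⟨?_, by simp; omega⟩
    exact he.sumElim (Fin.rev_injective.comp he) hrev
  let E : Fin r ⊕ Fin r ≃ Fin (2 * r) := Equiv.ofBijective f hf
  have hEl : ∀ i, E.symm (e i) = Sum.inl i := fun i => E.symm_apply_eq.2 rfl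
  have hEr : ∀ i, E.symm (e i).rev = Sum.inr i := fun i => E.symm_apply_eq.2 rfl
  let D : Matrix (Fin r) (Fin r) ℤ := Matrix.diagonal fun i => (-1) ^ ((e i : ℕ) + 1)
  have hDD : D * D = 1 := by
    simp [D, Matrix.diagonal_mul_diagonal, ← pow_add, ← two_mul]
  have hDt : D.transpose = D := Matrix.diagonal_transpose _
  have hJ : Jmat r = (Matrix.fromBlocks 0 D (-D) 0).submatrix E.symm E.symm := by
    refine (Matrix.reindex E E).symm_apply_eq.1 ?_
    ext (i | i) (j | j)
    · have := hrev i j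
      have h : ¬ ((e i : ℕ) + (e j : ℕ) = 2 * r - 1) := fun h => this (by
        ext; rw [Fin.val_rev]; omega)
      simp [Jmat, E, f, h]
    · by_cases hij : i = j
      · subst hij
        have h : (e i : ℕ) + (2 * r - ((e i : ℕ) + 1)) = 2 * r - 1 := by omega
        simp [Jmat, E, f, D, h]
      · have h : ¬ ((e i : ℕ) + (2 * r - ((e j : ℕ) + 1)) = 2 * r - 1) := fun h =>
          hij (he (by ext; omega))
        simp [Jmat, E, f, D, h, hij]
    · by_cases hij : i = j
      · subst hij
        have h : (2 * r - ((e i : ℕ) + 1)) + (e i : ℕ) = 2 * r - 1 := by omega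
        have hs : (-1 : ℤ) ^ (2 * r - ((e i : ℕ) + 1) + 1) = -(-1) ^ ((e i : ℕ) + 1) := by
          have h2 : 2 * r - ((e i : ℕ) + 1) + 1 = 2 * r - (e i : ℕ) := by omega
          rw [h2]
          rcases Nat.even_or_odd (e i : ℕ) with hp | hp
          · rw [Even.neg_one_pow ((even_two_mul r).tsub hp),
              Odd.neg_one_pow hp.add_one]; norm_num
          · rw [Odd.neg_one_pow (Nat.Even.sub_odd (by omega) (even_two_mul r) hp),
              Even.neg_one_pow hp.add_one]
        simp [Jmat, E, f, D, h, hs]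
      · have h : ¬ ((2 * r - ((e i : ℕ) + 1)) + (e j : ℕ) = 2 * r - 1) := fun h =>
          hij (he (by ext; omega))
        simp [Jmat, E, f, D, h, hij]
    · have := hrev i j
      have h : ¬ ((2 * r - ((e i : ℕ) + 1)) + (2 * r - ((e j : ℕ) + 1)) = 2 * r - 1) :=
        fun h => this (by ext; rw [Fin.val_rev]; omega)
      simp [Jmat, E, f, h]
  refine ⟨(Matrix.fromBlocks g 0 0 (D * k.transpose * D)).submatrix E.symm E.symm,
    (Matrix.fromBlocks k 0 0 (D * g.transpose * D)).submatrix E.symm E.symm,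
    ?_, ?_, ?_, ?_, ?_, ?_⟩
  · have h₁ : g.transpose * D * (D * k.transpose * D) = D := by
      calc g.transpose * D * (D * k.transpose * D)
          = g.transpose * (D * D) * k.transpose * D := by simp only [Matrix.mul_assoc]
        _ = D := by
          rw [hDD, Matrix.mul_one, ← Matrix.transpose_mul, hkg, Matrix.transpose_one,
            Matrix.one_mul]
    have h₂ : D * (k * D) * D * g = D := by
      calc D * (k * D) * D * g = D * k * (D * D) * g := by simp only [Matrix.mul_assoc]
        _ = D := by rw [hDD, Matrix.mul_one, Matrix.mul_assoc, hkg, Matrix.mul_one]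
    rw [IsSymplectic, hJ, Matrix.transpose_submatrix, Matrix.submatrix_mul_equiv,
      Matrix.submatrix_mul_equiv, Matrix.fromBlocks_transpose, Matrix.fromBlocks_multiply,
      Matrix.fromBlocks_multiply]
    simp [Matrix.transpose_mul, hDt, h₁, h₂]
  · have h₁ : D * g.transpose * D * (D * k.transpose * D) = 1 := by
      calc D * g.transpose * D * (D * k.transpose * D)
          = D * (g.transpose * (D * D) * k.transpose) * D := by simp only [Matrix.mul_assoc]
        _ = 1 := by
          rw [hDD, Matrix.mul_one, ← Matrix.transpose_mul, hkg, Matrix.transpose_one,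
            Matrix.mul_one, hDD]
    rw [Matrix.submatrix_mul_equiv, Matrix.fromBlocks_multiply]
    simp [hkg, h₁]
  · intro i j; simp [hEl]
  · intro i j; simp [hEl, hEr]
  · intro i j; simp [hEl, hEr]
  · intro v j
    simp only [Matrix.vecMul, dotProduct]
    rw [← E.sum_comp, Fintype.sum_sum_type]
    have hl : ∀ i, E (Sum.inl i) = e i := fun _ => rfl
    simp [hEl, hl]

/-- The last row of `M * i2mat r g`, when the last row of `M` starts with `0`. -/
theorem mul_i2mat_last_row {r : ℕ} (M : Matrix (Fin (2 * r)) (Fin (2 * r)) ℤ)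
    (g : Matrix (Fin 2) (Fin 2) ℤ) (o l : Fin (2 * r)) (ho : (o : ℕ) = 0)
    (hl : (l : ℕ) = 2 * r - 1) (hol : o ≠ l) (hM : M l o = 0) (j : Fin (2 * r)) :
    (M * i2mat r g) l j =
      if j = o then M l l * g 1 0 else if j = l then M l l * g 1 1 else M l j := by
  have hol' : (o : ℕ) ≠ l := fun h => hol (Fin.ext h)
  rw [Matrix.mul_apply]
  have key : ∀ k, k ≠ (if j = o then l else j) → M l k * i2mat r g k j = 0 := by
    intro k hk
    by_cases hko : k = o
    · rw [hko, hM, zero_mul]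
    · have hko' : (k : ℕ) ≠ o := fun h => hko (Fin.ext h)
      have : i2mat r g k j = 0 := by
        split_ifs at hk with hj
        · have hkl : (k : ℕ) ≠ l := fun h => hk (Fin.ext h)
          have hkj : k ≠ j := hj ▸ hko
          simp only [i2mat, Matrix.of_apply]
          rw [if_neg (by omega), if_neg (by omega), if_neg (by omega), if_neg (by omega),
            if_neg (by tauto)]
        · have hjo : (j : ℕ) ≠ o := fun h => hj (Fin.ext h)
          have hkj : (k : ℕ) ≠ j := fun h => hk (Fin.ext h)
          simp only [i2mat, Matrix.of_apply]
          rw [if_neg (by omega), if_neg (by omega), if_neg (by omega), if_neg (by omega),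
            if_neg (by tauto)]
      rw [this, mul_zero]
  rw [Finset.sum_eq_single_of_mem _ (Finset.mem_univ (if j = o then l else j))
    fun k _ hk => key k hk]
  by_cases hj : j = o
  · subst hj
    simp only [if_true, i2mat, Matrix.of_apply]
    rw [if_neg (by omega), if_neg (by omega), if_pos (by omega)]
  · have hjo : (j : ℕ) ≠ o := fun h => hj (Fin.ext h)
    rw [if_neg hj, if_neg hj]
    by_cases hjl : j = l
    · subst hjl
      simp only [if_true, i2mat, Matrix.of_apply]
      rw [if_neg (by omega), if_neg (by omega), if_neg (by omega), if_pos (by omega)]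
    · have hjl' : (j : ℕ) ≠ l := fun h => hjl (Fin.ext h)
      rw [if_neg hjl]
      simp only [i2mat, Matrix.of_apply]
      rw [if_neg (by omega), if_neg (by omega), if_neg (by omega), if_neg (by omega),
        if_pos (by have := j.isLt; exact ⟨trivial, by omega, by omega⟩), mul_one]

/-- Any two integers are a common multiple of the bottom row of some matrix in `SL₂(ℤ)`. -/
theorem exists_det_eq_one_mul_row_two (x m : ℤ) :
    ∃ (a : ℤ) (g : Matrix (Fin 2) (Fin 2) ℤ), g.det = 1 ∧ x = a * g 1 0 ∧ m = a * g 1 1 := by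
  obtain ⟨a, g, hg, h⟩ := exists_det_eq_one_smul_row (1 : Fin 2) ![x, m]
  exact ⟨a, g, hg, by simpa using congrFun h 0, by simpa using congrFun h 1⟩

/-- If `R = (R₁,…,R_{2r}) ∈ ℤ^{2r}` has `gcd(R₁,…,R_{2r}) = 1`, then there exist
`g₁, g₃ ∈ SL_r(ℤ)` and `g₂ ∈ SL₂(ℤ)` such that `i₁(g₁)·i₂(g₂)·i₃(g₃) ∈ Sp_{2r}(ℤ)`
has bottom row `R`. -/
theorem stmt19 (r : ℕ) (hr : 2 ≤ r) (R : Fin (2 * r) → ℤ)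
    (hR : Finset.gcd Finset.univ R = 1) :
    ∃ (g₁ g₃ : Matrix (Fin r) (Fin r) ℤ) (g₂ : Matrix (Fin 2) (Fin 2) ℤ)
      (M₁ M₃ : Matrix (Fin (2 * r)) (Fin (2 * r)) ℤ),
      g₁.det = 1 ∧ g₃.det = 1 ∧ g₂.det = 1 ∧
      IsI1Of r hr g₁ M₁ ∧ IsI3Of r g₃ M₃ ∧
      ∀ j : Fin (2 * r), (M₁ * i2mat r g₂ * M₃) ⟨2 * r - 1, by omega⟩ j = R j := by
  let o : Fin (2 * r) := ⟨0, by omega⟩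
  let l : Fin (2 * r) := ⟨2 * r - 1, by omega⟩
  let p : Fin r := ⟨r - 1, by omega⟩
  have hol : o ≠ l := by
    intro h
    have := congrArg Fin.val h
    simp only [o, l] at this
    omega
  let e₃ : Fin r → Fin (2 * r) := fun i => ⟨r + i, by omega⟩
  let e₁ : Fin r → Fin (2 * r) := fun i =>
    if (i : ℕ) < r - 1 then ⟨1 + i, by omega⟩ else l
  have he₁ : ∀ i : Fin r, (e₁ i : ℕ) = if (i : ℕ) < r - 1 then 1 + (i : ℕ) else 2 * r - 1 := by
    intro i
    simp only [e₁]
    split_ifs <;> rfl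
  have he₁' : ∀ (i : ℕ) (hi : i < r - 1), e₁ ⟨i, by omega⟩ = ⟨1 + i, by omega⟩ :=
    fun i hi => if_pos hi
  have he₁p : e₁ p = l := if_neg (lt_irrefl _)
  have hrev₁ : ∀ (j : ℕ) (hj : r ≤ j ∧ j ≤ 2 * r - 2),
      (⟨j, by omega⟩ : Fin (2 * r)) = (e₁ ⟨2 * r - 2 - j, by omega⟩).rev := by
    intro j hj
    rw [he₁' _ (by omega)]
    ext
    simp only [Fin.val_rev]
    omega
  have hrevo : o = (e₁ p).rev := by
    rw [he₁p]
    ext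
    simp only [Fin.val_rev, o, l]
    omega
  -- The right factor makes the second half of `R` a multiple of the last basis vector.
  obtain ⟨m, h, hh, hB⟩ := exists_det_eq_one_smul_row p (R ∘ e₃)
  have hhu : IsUnit h.det := by simp [hh]
  obtain ⟨M₃, N, hM₃, hNM, hM₃e, hM₃r, hM₃l, hN⟩ := exists_isSymplectic_of_polarization e₃
    (fun i j hij => by
      have := congrArg Fin.val hij
      simp only [e₃] at this
      ext; omega)
    (fun i j hij => by
      have := congrArg Fin.val hij
      simp only [e₃, Fin.val_rev] at this
      omega) h h⁻¹ (Matrix.nonsing_inv_mul _ hhu)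
  set u := Matrix.vecMul R N with hu
  have huR : Matrix.vecMul u M₃ = R := by
    rw [hu, Matrix.vecMul_vecMul, hNM, Matrix.vecMul_one]
  have hu₃ : ∀ j, u (e₃ j) = if j = p then m else 0 := by
    intro j
    have hrow : Matrix.vecMul (h p) h⁻¹ j = (1 : Matrix (Fin r) (Fin r) ℤ) p j := by
      rw [← Matrix.mul_nonsing_inv h hhu]
      rfl
    rw [hu, hN, hB, Matrix.smul_vecMul, Pi.smul_apply, hrow, Matrix.one_apply]
    simp [eq_comm]
  have hul : u l = m := by
    have : l = e₃ p := by ext; simp only [l, e₃, p]; omega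
    rw [this, hu₃, if_pos rfl]
  have hu0 : ∀ (j : ℕ) (hj : r ≤ j ∧ j ≤ 2 * r - 2), u ⟨j, by omega⟩ = 0 := by
    intro j hj
    have : (⟨j, by omega⟩ : Fin (2 * r)) = e₃ ⟨j - r, by omega⟩ := by
      ext; simp only [e₃]; omega
    rw [this, hu₃, if_neg]
    intro hc
    have := congrArg Fin.val hc
    simp only [p] at this
    omega
  obtain ⟨a, g₂, hg₂, hc, hd⟩ := exists_det_eq_one_mul_row_two (u o) m
  let z : Fin r → ℤ := fun j => if j = p then a else u (e₁ j)
  have hcases : ∀ j : Fin (2 * r), j = o ∨ j = l ∨ (∃ i : Fin r, i ≠ p ∧ j = e₁ i) ∨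
      (r ≤ (j : ℕ) ∧ (j : ℕ) ≤ 2 * r - 2) := by
    intro j
    by_cases h0 : (j : ℕ) = 0
    · exact Or.inl (Fin.ext h0)
    by_cases h1 : (j : ℕ) = 2 * r - 1
    · exact Or.inr (Or.inl (Fin.ext h1))
    by_cases h2 : (j : ℕ) < r
    · refine Or.inr (Or.inr (Or.inl ⟨⟨(j : ℕ) - 1, by omega⟩, ?_, ?_⟩))
      · intro hc
        have := congrArg Fin.val hc
        simp only [p] at this
        omega
      · rw [he₁' _ (by omega)]
        ext
        simp only
        omega
    · exact Or.inr (Or.inr (Or.inr (by omega)))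
  have hz : ∀ d : ℤ, (∀ j, d ∣ z j) → IsUnit d := by
    intro d hdz
    have hda : d ∣ a := by simpa [z] using hdz p
    have hdu : ∀ j, d ∣ u j := by
      intro j
      rcases hcases j with rfl | rfl | ⟨i, hi, rfl⟩ | hj
      · exact hc ▸ hda.mul_right _
      · exact hul ▸ hd ▸ hda.mul_right _
      · simpa [z, hi] using hdz i
      · exact hu0 j hj ▸ dvd_zero d
    have hdR : d ∣ Finset.gcd Finset.univ R := Finset.dvd_gcd fun j _ => by
      rw [← huR]
      exact Finset.dvd_sum (s := Finset.univ) (f := fun k => u k * M₃ k j)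
        fun k _ => (hdu k).mul_right _
    exact isUnit_of_dvd_one (hR ▸ hdR)
  obtain ⟨g₁, hg₁, hg₁z⟩ := exists_det_eq_one_row_eq (l := p) (i := ⟨0, by omega⟩)
    (by intro hc
        have := congrArg Fin.val hc
        simp only [p] at this
        omega) z hz
  have hg₁u : IsUnit g₁.det := by simp [hg₁]
  obtain ⟨M₁, -, hM₁, -, hM₁e, hM₁r, hM₁l, -⟩ := exists_isSymplectic_of_polarization e₁
    (fun i j hij => by
      have := congrArg Fin.val hij
      rw [he₁, he₁] at this
      ext
      split_ifs at this <;> omega)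
    (fun i j hij => by
      have := congrArg Fin.val hij
      rw [Fin.val_rev, he₁, he₁] at this
      split_ifs at this <;> omega) g₁ g₁⁻¹ (Matrix.nonsing_inv_mul _ hg₁u)
  have hM₁lo : M₁ l o = 0 := by rw [hrevo, ← he₁p, hM₁r]
  have hM₁ll : M₁ l l = a := by rw [← he₁p, hM₁e, hg₁z]; simp [z]
  have hrow1 : ∀ (i : ℕ) (hi : 1 ≤ i ∧ i ≤ r - 1),
      (⟨i, by omega⟩ : Fin (2 * r)) = e₁ ⟨i - 1, by omega⟩ := by
    intro i hi
    rw [he₁' _ (by omega)]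
    ext
    simp only
    omega
  have hM₁z : ∀ (j : ℕ) (hj : r ≤ j ∧ j ≤ 2 * r - 2), M₁ l ⟨j, by omega⟩ = 0 := by
    intro j hj
    rw [hrev₁ j hj, ← he₁p, hM₁r]
  refine ⟨g₁, h, g₂, M₁, M₃, hg₁, hh, hg₂, ?_, ?_, ?_⟩
  · refine ⟨hM₁, ?_, ?_, ?_, ?_, ?_, ?_, ?_, ?_, hM₁lo, hM₁z⟩
    · intro i j hi hj
      rw [← he₁' i hi, ← he₁' j hj, hM₁e]
    · intro i hi
      rw [← he₁' i hi, ← hM₁e, he₁p]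
    · intro j hj
      rw [← he₁' j hj, ← hM₁e, he₁p]
    · rw [← hM₁e, he₁p]
    · intro j hj
      change M₁ o _ = 0
      rw [hrow1 j hj, hrevo, hM₁l]
    · change M₁ o l = 0
      rw [hrevo, ← he₁p, hM₁l]
    · intro i hi
      refine ⟨?_, fun j hj => ?_⟩
      · change M₁ _ o = 0
        rw [hrow1 i hi, hrevo, hM₁r]
      · rw [hrow1 i hi, hrev₁ j hj, hM₁r]
    · intro i hi
      refine ⟨fun j hj => ?_, ?_⟩
      · rw [hrev₁ i hi, hrow1 j hj, hM₁l]
      · change M₁ _ l = 0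
        rw [hrev₁ i hi, ← he₁p, hM₁l]
  · have hlow : ∀ i : Fin (2 * r), ∀ hi : r ≤ (i : ℕ), i = e₃ ⟨(i : ℕ) - r, by omega⟩ := by
      intro i hi
      ext
      simp only [e₃]
      omega
    have hhigh : ∀ i : Fin (2 * r), ∀ hi : (i : ℕ) < r,
        i = (e₃ ⟨r - 1 - (i : ℕ), by omega⟩).rev := by
      intro i hi
      ext
      simp only [e₃, Fin.val_rev]
      omega
    refine ⟨hM₃, fun i j hi hj => ?_, fun i j hij => ?_⟩
    · rw [← hM₃e, ← hlow i hi, ← hlow j hj]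
    · rcases hij with ⟨hi, hj⟩ | ⟨hj, hi⟩
      · rw [hhigh i hi, hlow j hj, hM₃l]
      · rw [hlow i hi, hhigh j hj, hM₃r]
  · intro j
    have hu' : ∀ k, (M₁ * i2mat r g₂) l k = u k := by
      intro k
      rw [mul_i2mat_last_row M₁ g₂ o l rfl rfl hol hM₁lo]
      rcases hcases k with rfl | rfl | ⟨i, hi, rfl⟩ | hk
      · rw [if_pos rfl, hM₁ll, hc]
      · rw [if_neg hol.symm, if_pos rfl, hM₁ll, hul, hd]
      · have hip : (i : ℕ) < r - 1 := by
          have : (i : ℕ) ≠ r - 1 := fun hc => hi (Fin.ext hc)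
          omega
        have hv := he₁ i
        rw [if_pos hip] at hv
        rw [if_neg, if_neg, ← he₁p, hM₁e, hg₁z]
        · simp [z, hi]
        · intro hc
          have := congrArg Fin.val hc
          simp only [l] at this
          omega
        · intro hc
          have := congrArg Fin.val hc
          simp only [o] at this
          omega
      · rw [if_neg, if_neg, hM₁z k hk, hu0 k hk]
        · intro hc
          have := congrArg Fin.val hc
          simp only [l] at this
          omega
        · intro hc
          have := congrArg Fin.val hc
          simp only [o] at this
          omega
    change Matrix.vecMul ((M₁ * i2mat r g₂) l) M₃ j = R j
    rw [funext hu', huR]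

end Stmt19
end
end
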